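/- Let n ≥ 1 and let f, g ∈ L¹(ℂ^n × ℝ) both be radial in z. Define the Heisenberg convolution f*g(w) = ∫_{ℂ^n×ℝ} f(w·v^{-1}) g(v) dv, where the group law is (z,s)·(z',s') = (z+z', s+s'+2 Im(z·z̄')) and (z,s)^{-1} = (-z,-s). Then f*g ∈ L¹(ℂ^n × ℝ) and for every m ∈ ℕ and λ ∈ ℝ the spherical Fourier transform satisfies (f*g)^(m,λ) = f̂(m,λ) · ĝ(m,λ). -/

import Mathlib

open MeasureTheory

/-- Squared Euclidean norm of `z ∈ ℂⁿ`. -/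
noncomputable def hnormSq {n : ℕ} (z : Fin n → ℂ) : ℝ := ∑ j, Complex.normSq (z j)

/-- The Hermitean product `z·z̄' = Σ z_j conj(z'_j)` on `ℂⁿ`. -/
noncomputable def hprod {n : ℕ} (z w : Fin n → ℂ) : ℂ := ∑ j, z j * (starRingEnd ℂ) (w j)

/-- Heisenberg group law on `ℂⁿ × ℝ`:
`(z,s)·(z',s') = (z+z', s+s'+2 Im(z·z̄'))`. -/
noncomputable def hMul {n : ℕ} (w v : (Fin n → ℂ) × ℝ) : (Fin n → ℂ) × ℝ :=
  (w.1 + v.1, w.2 + v.2 + 2 * (hprod w.1 v.1).im)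

/-- Heisenberg group inverse: `(z,s)⁻¹ = (-z,-s)`. -/
noncomputable def hInv {n : ℕ} (v : (Fin n → ℂ) × ℝ) : (Fin n → ℂ) × ℝ := (-v.1, -v.2)

/-- Laguerre polynomial of type `d` and degree `m`. -/
noncomputable def laguerreL (d m : ℕ) (t : ℝ) : ℝ :=
  ∑ k ∈ Finset.range (m + 1),
    (-1 : ℝ) ^ k * (Nat.choose (m + d) (m - k)) * t ^ k / (Nat.factorial k)

/-- Spherical Fourier transform on the Heisenberg group `Hⁿ = ℂⁿ × ℝ`. -/
noncomputable def sphFT (n : ℕ) (f : (Fin n → ℂ) × ℝ → ℂ) (m : ℕ) (lam : ℝ) : ℂ :=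
  ((Nat.choose (m + n - 1) m : ℂ))⁻¹ *
    ∫ p : (Fin n → ℂ) × ℝ,
      Complex.exp (Complex.I * lam * p.2) * f p *
        ((laguerreL (n - 1) m (2 * |lam| * hnormSq p.1) *
          Real.exp (-(|lam| * hnormSq p.1)) : ℝ) : ℂ)

/-- Heisenberg convolution `f*g(w) = ∫ f(w·v⁻¹) g(v) dv`. -/
noncomputable def hConv {n : ℕ} (f g : (Fin n → ℂ) × ℝ → ℂ) (w : (Fin n → ℂ) × ℝ) : ℂ :=
  ∫ v : (Fin n → ℂ) × ℝ, f (hMul w (hInv v)) * g v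


lemma lag_hasSum (d : ℕ) (x t : ℝ) (ht : |t| < 1) :
    HasSum (fun m => t ^ m * laguerreL d m x)
      (((1 - t) ^ (d + 1))⁻¹ * Real.exp (-(x * t / (1 - t)))) := by
  have h1t : 0 < 1 - t := by have := abs_lt.1 ht; linarith
  -- general double family
  have key : ∀ (x t : ℝ), |t| < 1 → ∀ k : ℕ, HasSum (fun j : ℕ =>
      (-x * t) ^ k / (k.factorial) * ((j + (k + d)).choose (k + d) * t ^ j))
      ((-x * t) ^ k / (k.factorial) * (1 / (1 - t) ^ (k + d + 1))) := by
    intro x t ht k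
    exact (hasSum_choose_mul_geometric_of_norm_lt_one (𝕜 := ℝ) (k + d) (by simpa using ht)).mul_left _
  have key2 : ∀ (x t : ℝ), |t| < 1 → HasSum (fun k : ℕ =>
      ((-x * t) ^ k / (k.factorial) * (1 / (1 - t) ^ (k + d + 1))))
      (((1 - t) ^ (d + 1))⁻¹ * Real.exp (-(x * t / (1 - t)))) := by
    intro x t ht
    have h1t : 0 < 1 - t := by have := abs_lt.1 ht; linarith
    have := (NormedSpace.expSeries_div_hasSum_exp (𝔸 := ℝ) (-(x * t / (1 - t))))
    rw [← Real.exp_eq_exp_ℝ] at this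
    convert! this.mul_left (((1 - t) ^ (d + 1))⁻¹) using 2 with k
    rw [← neg_div, div_pow, pow_add, pow_add, pow_add]
    field_simp
  set G : ℕ × ℕ → ℝ := fun p => (-x * t) ^ p.1 / (p.1.factorial) *
    ((p.2 + (p.1 + d)).choose (p.1 + d) * t ^ p.2) with hG
  have hsum : Summable G := by
    have habs : |(|t|)| < 1 := by simpa using ht
    apply Summable.of_norm
    have hn : (fun p => ‖G p‖) = fun p : ℕ × ℕ => (-(-|x|) * |t|) ^ p.1 / (p.1.factorial) *
        ((p.2 + (p.1 + d)).choose (p.1 + d) * |t| ^ p.2) := by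
      funext p
      simp [hG]
    rw [hn, summable_prod_of_nonneg (by intro p; dsimp only [Pi.zero_apply]; rw [neg_neg]; positivity)]
    refine ⟨fun k => (key (-|x|) |t| habs k).summable, ?_⟩
    have := (key2 (-|x|) |t| habs).summable
    convert this using 2 with k
    exact (key (-|x|) |t| habs k).tsum_eq
  have hG1 : HasSum G (((1 - t) ^ (d + 1))⁻¹ * Real.exp (-(x * t / (1 - t)))) := by
    have h := hsum.hasSum
    have h2 := h.prod_fiberwise (key x t ht)
    rwa [h2.unique (key2 x t ht)] at h
  have h3 := (Finset.HasAntidiagonal.sigmaAntidiagonalEquivProd (A := ℕ)).hasSum_iff.2 hG1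
  have h4 := h3.sigma (fun m => hasSum_fintype _)
  convert! h4 using 2 with m
  rw [laguerreL, Finset.mul_sum]
  rw [← Finset.Nat.sum_antidiagonal_eq_sum_range_succ_mk (f := fun p : ℕ × ℕ =>
    t ^ m * ((-1 : ℝ) ^ p.1 * (Nat.choose (m + d) (m - p.1)) * x ^ p.1 / (Nat.factorial p.1)))]
  rw [← Finset.sum_coe_sort]
  refine Finset.sum_congr rfl fun p _ => ?_
  obtain ⟨⟨k, j⟩, hp⟩ := p
  rw [Finset.HasAntidiagonal.mem_antidiagonal] at hp
  simp only at hp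
  subst hp
  simp only [hG, Finset.HasAntidiagonal.sigmaAntidiagonalEquivProd, Function.comp, Equiv.coe_fn_mk]
  have : (k + j + d).choose (k + j - k) = (j + (k + d)).choose (k + d) := by
    rw [Nat.add_sub_cancel_left, show k + j + d = j + (k + d) by ring]
    exact Nat.choose_symm_add
  rw [this, pow_add, mul_pow, neg_pow]
  ring

lemma lag_abs_le (d m : ℕ) (x : ℝ) (hx : 0 ≤ x) : |laguerreL d m x| ≤ laguerreL d m (-x) := by
  unfold laguerreL
  refine (Finset.abs_sum_le_sum_abs _ _).trans (le_of_eq (Finset.sum_congr rfl fun k _ => ?_))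
  rw [neg_pow x, abs_div, abs_mul, abs_mul, abs_pow, abs_pow, abs_neg, abs_of_nonneg hx]
  have : (-1 : ℝ) ^ k * (-1) ^ k = 1 := by rw [← mul_pow]; simp
  simp only [abs_one, one_pow, Nat.abs_cast, one_mul]
  linear_combination (-((Nat.choose (m + d) (m - k)) * x ^ k / (Nat.factorial k) : ℝ)) * this

lemma lag_zero (d m : ℕ) : laguerreL d m 0 = (m + d).choose m := by
  unfold laguerreL
  rw [Finset.sum_eq_single 0]
  · simp
  · intro k _ hk; simp [hk]
  · simp

lemma lag_cont (d m : ℕ) : Continuous (laguerreL d m) := by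
  unfold laguerreL; fun_prop

lemma lag_bound (d m : ℕ) : ∃ C, ∀ x : ℝ, 0 ≤ x → |laguerreL d m x| ≤ C * Real.exp (x / 2) := by
  refine ⟨3 ^ m * ((1 - (1/3 : ℝ)) ^ (d + 1))⁻¹, fun x hx => ?_⟩
  have h := lag_hasSum d (-x) (1/3) (by norm_num [abs_of_pos])
  have h1 := le_hasSum h m (fun j _ => mul_nonneg (by positivity)
    ((abs_nonneg _).trans (lag_abs_le d j x hx)))
  rw [show -(-x * (1/3) / (1 - 1/3)) = x / 2 by ring, one_div, inv_pow,
    inv_mul_le_iff₀ (by positivity)] at h1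
  refine (lag_abs_le d m x hx).trans (h1.trans (le_of_eq (by rw [one_div]; ring)))

noncomputable def serOf (a : ℕ → ℂ) : FormalMultilinearSeries ℝ ℝ ℂ :=
  fun n => ContinuousMultilinearMap.mkPiRing ℝ (Fin n) (a n)

lemma serOf_coeff (a : ℕ → ℂ) (n : ℕ) : (serOf a).coeff n = a n := by
  change ContinuousMultilinearMap.mkPiRing ℝ (Fin n) (a n) 1 = a n
  rw [ContinuousMultilinearMap.mkPiRing_apply]
  simp

lemma coeff_unique (a b : ℕ → ℂ) (r : ℝ) (hr : 0 < r) (F : ℝ → ℂ)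
    (ha : ∀ t : ℝ, |t| < r → HasSum (fun m => ((t ^ m : ℝ) : ℂ) * a m) (F t))
    (hb : ∀ t : ℝ, |t| < r → HasSum (fun m => ((t ^ m : ℝ) : ℂ) * b m) (F t)) (m : ℕ) : a m = b m := by
  have H : ∀ a : ℕ → ℂ, (∀ t : ℝ, |t| < r → HasSum (fun m => ((t ^ m : ℝ) : ℂ) * a m) (F t)) →
      HasFPowerSeriesAt (𝕜 := ℝ) (E := ℝ) F
        (serOf a) 0 := by
    intro a ha
    refine hasFPowerSeriesAt_iff.2 ?_
    filter_upwards [Metric.ball_mem_nhds (0:ℝ) hr] with t ht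
    have := ha t (by simpa using ht)
    simpa only [serOf_coeff, zero_add, Complex.real_smul] using this
  have h := (H a ha).eq_formalMultilinearSeries (H b hb)
  have h2 := congrArg (fun p => FormalMultilinearSeries.coeff p m) h
  simpa only [serOf_coeff] using h2

lemma gauss1 (b : ℝ) (hb : 0 < b) (p q : ℂ) :
    ∫ z : ℂ, Complex.exp (-b * (Complex.normSq z : ℝ) + (p * z.re + q * z.im)) =
      (Real.pi / b : ℂ) * Complex.exp ((p ^ 2 + q ^ 2) / (4 * b)) := by
  have hb0 : (b : ℂ) ≠ 0 := by exact_mod_cast hb.ne'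
  rw [← (Complex.volume_preserving_equiv_real_prod.symm).integral_comp
    Complex.measurableEquivRealProd.symm.measurableEmbedding]
  have : ∀ x : ℝ × ℝ, Complex.exp (-b * (Complex.normSq (Complex.measurableEquivRealProd.symm x) : ℝ)
      + (p * (Complex.measurableEquivRealProd.symm x).re
        + q * (Complex.measurableEquivRealProd.symm x).im)) =
      Complex.exp (-b * x.1 ^ 2 + p * x.1 + 0) * Complex.exp (-b * x.2 ^ 2 + q * x.2 + 0) := by
    intro x
    rw [← Complex.exp_add]
    congr 1
    simp [Complex.normSq_apply]
    ring
  simp_rw [this]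
  rw [Measure.volume_eq_prod, integral_prod_mul (fun x : ℝ => Complex.exp (-b * x ^ 2 + p * x + 0))
    (fun x : ℝ => Complex.exp (-b * x ^ 2 + q * x + 0)),
    integral_cexp_quadratic (by simpa using hb), integral_cexp_quadratic (by simpa using hb)]
  have h2 : ((Real.pi : ℂ) / - -(b : ℂ)) ^ (1 / 2 : ℂ) * ((Real.pi : ℂ) / - -(b : ℂ)) ^ (1 / 2 : ℂ) = Real.pi / b := by
    have h0 : (Real.pi : ℂ) / b ≠ 0 := div_ne_zero (by exact_mod_cast Real.pi_ne_zero) hb0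
    rw [neg_neg, ← Complex.cpow_add _ _ h0]
    norm_num
  rw [mul_mul_mul_comm, h2, ← Complex.exp_add]
  congr 2
  field_simp
  ring

lemma gaussn {n : ℕ} (b : ℝ) (hb : 0 < b) (p q : Fin n → ℂ) :
    ∫ z : Fin n → ℂ, Complex.exp (-b * (hnormSq z : ℝ) + ∑ j, (p j * (z j).re + q j * (z j).im)) =
      (Real.pi / b : ℂ) ^ n * Complex.exp ((∑ j, (p j ^ 2 + q j ^ 2)) / (4 * b)) := by
  have : ∀ z : Fin n → ℂ,
      Complex.exp (-b * (hnormSq z : ℝ) + ∑ j, (p j * (z j).re + q j * (z j).im)) =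
      ∏ j, Complex.exp (-b * (Complex.normSq (z j) : ℝ) + (p j * (z j).re + q j * (z j).im)) := by
    intro z
    rw [← Complex.exp_sum, hnormSq, Complex.ofReal_sum, Finset.mul_sum, ← Finset.sum_add_distrib]
  simp_rw [this]
  rw [integral_fintype_prod_volume_eq_prod (fun j (w : ℂ) =>
    Complex.exp (-b * (Complex.normSq w : ℝ) + (p j * w.re + q j * w.im)))]
  simp_rw [gauss1 b hb]
  rw [Finset.prod_mul_distrib, ← Complex.exp_sum, Finset.sum_div]
  simp [div_pow]

lemma hnormSq_cont {n : ℕ} : Continuous (hnormSq (n := n)) := by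
  unfold hnormSq
  have := Complex.continuous_normSq
  fun_prop

lemma hnormSq_nonneg {n : ℕ} (z : Fin n → ℂ) : 0 ≤ hnormSq z :=
  Finset.sum_nonneg fun _ _ => Complex.normSq_nonneg _

lemma gauss_integrable {n : ℕ} (s : ℝ) (hs : 0 < s) :
    Integrable (fun z : Fin n → ℂ => Real.exp (-s * hnormSq z)) := by
  have h1 : Integrable (fun z : ℂ => Real.exp (-s * Complex.normSq z)) := by
    rw [← (Complex.volume_preserving_equiv_real_prod.symm).integrable_comp_emb
      Complex.measurableEquivRealProd.symm.measurableEmbedding]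
    have : ((fun z : ℂ => Real.exp (-s * Complex.normSq z)) ∘ Complex.measurableEquivRealProd.symm)
      = fun x : ℝ × ℝ => Real.exp (-s * x.1 ^ 2) * Real.exp (-s * x.2 ^ 2) := by
      funext x
      rw [← Real.exp_add]
      simp [Complex.normSq_apply]
      ring
    rw [this]
    exact (integrable_exp_neg_mul_sq hs).mul_prod (integrable_exp_neg_mul_sq hs)
  have h2 := Integrable.fintype_prod (ι := Fin n) (f := fun _ (z : ℂ) => Real.exp (-s * Complex.normSq z))
    (μ := fun _ => volume) (fun _ => h1)
  convert! h2 using 2 with z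
  rw [← Real.exp_sum, hnormSq, Finset.mul_sum]

noncomputable def psi (n m : ℕ) (lam : ℝ) (z : Fin n → ℂ) : ℝ :=
  laguerreL (n - 1) m (2 * |lam| * hnormSq z) * Real.exp (-(|lam| * hnormSq z))

lemma psi_cont (n m : ℕ) (lam : ℝ) : Continuous (psi n m lam) := by
  unfold psi
  have := lag_cont (n - 1) m
  have := hnormSq_cont (n := n)
  fun_prop

lemma psi_bound (n m : ℕ) (lam : ℝ) : ∃ C, ∀ z, |psi n m lam z| ≤ C := by
  obtain ⟨C, hC⟩ := lag_bound (n - 1) m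
  refine ⟨C, fun z => ?_⟩
  have h0 := hnormSq_nonneg z
  have h := hC (2 * |lam| * hnormSq z) (by positivity)
  rw [psi, abs_mul, Real.abs_exp]
  calc _ ≤ C * Real.exp (2 * |lam| * hnormSq z / 2) * Real.exp (-(|lam| * hnormSq z)) := by gcongr
    _ = C := by
      rw [mul_assoc, ← Real.exp_add]
      ring_nf
      simp

lemma psi_gen (n : ℕ) (hn : 1 ≤ n) (lam : ℝ) (z : Fin n → ℂ) (t : ℝ) (ht : |t| < 1) :
    HasSum (fun m => t ^ m * psi n m lam z)
      (((1 - t) ^ n)⁻¹ * Real.exp (-(|lam| * ((1 + t) / (1 - t)) * hnormSq z))) := by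
  have h1t : 0 < 1 - t := by have := abs_lt.1 ht; linarith
  have h := (lag_hasSum (n - 1) (2 * |lam| * hnormSq z) t ht).mul_right
    (Real.exp (-(|lam| * hnormSq z)))
  rw [Nat.sub_add_cancel hn, mul_assoc ((1 - t) ^ n)⁻¹, ← Real.exp_add] at h
  convert! h using 2 with m
  · rw [psi]; ring
  · congr 1
    field_simp
    ring

/-- Gaussian-weighted twisted integral. -/
noncomputable def Iint (n m : ℕ) (lam s : ℝ) (w : Fin n → ℂ) : ℂ :=
  ∫ z : Fin n → ℂ, (Real.exp (-s * hnormSq z) : ℂ) *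
    (Complex.exp (Complex.I * (2 * lam * (hprod z w).im : ℝ)) * (psi n m lam (z + w) : ℂ))

lemma hprod_cont {n : ℕ} (w : Fin n → ℂ) : Continuous (fun z => (hprod z w).im) := by
  unfold hprod
  fun_prop

lemma norm_phase (x : ℝ) : ‖Complex.exp (Complex.I * (x : ℂ))‖ = 1 := by
  rw [mul_comm]; exact Complex.norm_exp_ofReal_mul_I x

lemma Iint_hasSum (n : ℕ) (hn : 1 ≤ n) (lam s : ℝ) (hs : 0 < s) (w : Fin n → ℂ) (t : ℝ)
    (ht : |t| < 1 / 3) :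
    HasSum (fun m => ((t ^ m : ℝ) : ℂ) * Iint n m lam s w)
      (∫ z : Fin n → ℂ, (Real.exp (-s * hnormSq z) : ℂ) *
        (Complex.exp (Complex.I * (2 * lam * (hprod z w).im : ℝ)) *
          ((((1 - t) ^ n)⁻¹ *
            Real.exp (-(|lam| * ((1 + t) / (1 - t)) * hnormSq (z + w))) : ℝ) : ℂ))) := by
  have ht1 : |t| < 1 := by linarith
  have hta : |(|t|)| < 1 := by simpa using ht1
  have c1 := hnormSq_cont (n := n)
  have c2 := hprod_cont w
  have e1 : ∀ m, ((t ^ m : ℝ) : ℂ) * Iint n m lam s w = ∫ z : Fin n → ℂ,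
      ((t ^ m : ℝ) : ℂ) * ((Real.exp (-s * hnormSq z) : ℂ) *
    (Complex.exp (Complex.I * (2 * lam * (hprod z w).im : ℝ)) * (psi n m lam (z + w) : ℂ))) := by
    intro m; rw [Iint, integral_const_mul]
  simp_rw [e1]
  set B : ℕ → (Fin n → ℂ) → ℝ := fun m z => Real.exp (-s * hnormSq z) *
    (Real.exp (-(|lam| * hnormSq (z + w))) *
      (|t| ^ m * laguerreL (n - 1) m (-(2 * |lam| * hnormSq (z + w))))) with hB
  have hBs : ∀ z, HasSum (fun m => B m z) (Real.exp (-s * hnormSq z) *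
    (Real.exp (-(|lam| * hnormSq (z + w))) * (((1 - |t|) ^ (n - 1 + 1))⁻¹ *
      Real.exp (-(-(2 * |lam| * hnormSq (z + w)) * |t| / (1 - |t|)))))) := fun z =>
    ((lag_hasSum (n - 1) _ |t| hta).mul_left _).mul_left _
  have h1t : 0 < 1 - |t| := by linarith
  refine hasSum_integral_of_dominated_convergence B ?_ ?_ ?_ ?_ ?_
  · intro m
    have := psi_cont n m lam
    exact Continuous.aestronglyMeasurable (by fun_prop)
  · intro m
    refine Filter.Eventually.of_forall fun z => ?_
    have h0 := hnormSq_nonneg (z + w)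
    rw [norm_mul, norm_mul, norm_mul, norm_phase, Complex.norm_real, Complex.norm_real,
      Complex.norm_real, Real.norm_eq_abs, Real.norm_eq_abs, Real.norm_eq_abs, Real.abs_exp,
      abs_pow, psi, abs_mul, Real.abs_exp]
    have := lag_abs_le (n - 1) m (2 * |lam| * hnormSq (z + w)) (by positivity)
    have h3 : |t| ^ m * |laguerreL (n - 1) m (2 * |lam| * hnormSq (z + w))| ≤
      |t| ^ m * laguerreL (n - 1) m (-(2 * |lam| * hnormSq (z + w))) := by gcongr
    calc _ = Real.exp (-s * hnormSq z) *
        (Real.exp (-(|lam| * hnormSq (z + w))) *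
        (|t| ^ m * |laguerreL (n - 1) m (2 * |lam| * hnormSq (z + w))|)) := by ring
      _ ≤ B m z := by simp only [hB]; gcongr
  · exact Filter.Eventually.of_forall fun z => (hBs z).summable
  · simp_rw [fun z => (hBs z).tsum_eq]
    refine ((gauss_integrable s hs).mul_const (((1 - |t|) ^ (n - 1 + 1))⁻¹)).mono'
      (Continuous.aestronglyMeasurable (by fun_prop)) (Filter.Eventually.of_forall fun z => ?_)
    rw [Real.norm_of_nonneg (by positivity)]
    gcongr
    rw [mul_left_comm, ← Real.exp_add]
    refine mul_le_of_le_one_right (by positivity) (Real.exp_le_one_iff.2 ?_)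
    have h0 := hnormSq_nonneg (z + w)
    have h2 : |t| / (1 - |t|) ≤ 1 / 2 := by
      rw [div_le_div_iff₀ h1t (by norm_num)]; linarith
    have h4 : 0 ≤ |lam| * hnormSq (z + w) := by positivity
    have : -(|lam| * hnormSq (z + w)) + -(-(2 * |lam| * hnormSq (z + w)) * |t| / (1 - |t|))
      = (|lam| * hnormSq (z + w)) * (2 * (|t| / (1 - |t|)) - 1) := by ring
    rw [this]
    exact mul_nonpos_of_nonneg_of_nonpos h4 (by linarith)
  · refine Filter.Eventually.of_forall fun z => ?_
    have := Complex.hasSum_ofReal.2 (psi_gen n hn lam (z + w) t ht1)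
    have h := (this.mul_left (Complex.exp (Complex.I * (2 * lam * (hprod z w).im : ℝ)))).mul_left
      (Real.exp (-s * hnormSq z) : ℂ)
    convert! h using 2 with m
    push_cast
    ring

lemma Iint_closed (n : ℕ) (lam s : ℝ) (hs : 0 < s) (w : Fin n → ℂ) (t : ℝ)
    (ht : |t| < 1 / 3) :
    (∫ z : Fin n → ℂ, (Real.exp (-s * hnormSq z) : ℂ) *
        (Complex.exp (Complex.I * (2 * lam * (hprod z w).im : ℝ)) *
          ((((1 - t) ^ n)⁻¹ *
            Real.exp (-(|lam| * ((1 + t) / (1 - t)) * hnormSq (z + w))) : ℝ) : ℂ))) =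
    (((Real.pi / (s + |lam|)) ^ n *
      (((1 - t * ((s - |lam|) / (s + |lam|))) ^ n)⁻¹ *
        Real.exp (-(|lam| * ((1 + t * ((s - |lam|) / (s + |lam|))) /
          (1 - t * ((s - |lam|) / (s + |lam|)))) * hnormSq w))) : ℝ) : ℂ) := by
  obtain ⟨ht1, ht2⟩ := abs_lt.1 ht
  have h1t : 0 < 1 - t := by linarith
  set a := (1 + t) / (1 - t) with ha
  have ha0 : 0 < a := div_pos (by linarith) h1t
  have hL := abs_nonneg lam
  set L := |lam| with hLd
  have hb : 0 < s + a * L := by positivity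
  have hsL : 0 < s + L := by positivity
  set p : Fin n → ℂ := fun j => -2 * Complex.I * lam * (w j).im - 2 * a * L * (w j).re with hp
  set q : Fin n → ℂ := fun j => 2 * Complex.I * lam * (w j).re - 2 * a * L * (w j).im with hq
  have hadd : ∀ z : Fin n → ℂ, hnormSq (z + w) = hnormSq z + hnormSq w +
      ∑ j, 2 * ((z j).re * (w j).re + (z j).im * (w j).im) := by
    intro z
    simp only [hnormSq, ← Finset.sum_add_distrib]
    refine Finset.sum_congr rfl fun j _ => ?_
    simp [Complex.normSq_apply]
    ring
  have him : ∀ z : Fin n → ℂ, (hprod z w).im =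
      ∑ j, ((z j).im * (w j).re - (z j).re * (w j).im) := by
    intro z
    simp only [hprod, Complex.im_sum]
    refine Finset.sum_congr rfl fun j _ => ?_
    simp
    ring
  have hint : ∀ z : Fin n → ℂ, (Real.exp (-s * hnormSq z) : ℂ) *
        (Complex.exp (Complex.I * (2 * lam * (hprod z w).im : ℝ)) *
          ((((1 - t) ^ n)⁻¹ * Real.exp (-(L * a * hnormSq (z + w))) : ℝ) : ℂ)) =
      ((((1 - t) ^ n)⁻¹ : ℝ) * Complex.exp (-(a * L * hnormSq w : ℝ))) *
      Complex.exp (-((s + a * L : ℝ) : ℂ) * (hnormSq z : ℝ) +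
        ∑ j, (p j * (z j).re + q j * (z j).im)) := by
    intro z
    have hsum : ∑ j, (p j * (z j).re + q j * (z j).im) =
      Complex.I * (2 * lam * (hprod z w).im : ℝ) -
        ((a * L * ∑ j, 2 * ((z j).re * (w j).re + (z j).im * (w j).im) : ℝ) : ℂ) := by
      rw [him]
      push_cast
      simp only [Finset.mul_sum, ← Finset.sum_sub_distrib]
      refine Finset.sum_congr rfl fun j _ => ?_
      simp only [hp, hq]
      ring
    rw [hsum, hadd]
    simp only [Complex.ofReal_mul, Complex.ofReal_exp]
    rw [show ∀ A B C D : ℂ, A * (B * (C * D)) = C * (A * B * D) by intros; ring, mul_assoc (_ : ℂ) (Complex.exp (-_)),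
      ← Complex.exp_add, ← Complex.exp_add, ← Complex.exp_add]
    congr 2
    push_cast
    ring
  simp_rw [hint]
  rw [integral_const_mul, gaussn _ hb]
  have hpq : ∑ j, (p j ^ 2 + q j ^ 2) = ((4 * L ^ 2 * (a ^ 2 - 1) * hnormSq w : ℝ) : ℂ) := by
    rw [hnormSq, Finset.mul_sum, Complex.ofReal_sum]
    refine Finset.sum_congr rfl fun j _ => ?_
    have hl2 : (L : ℂ) ^ 2 = (lam : ℂ) ^ 2 := by
      rw [hLd]; exact_mod_cast sq_abs lam
    simp only [hp, hq, Complex.normSq_apply]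
    push_cast
    linear_combination (4 * lam ^ 2 * ((w j).im ^ 2 + (w j).re ^ 2) : ℂ) * Complex.I_sq +
      (4 * ((w j).im ^ 2 + (w j).re ^ 2) : ℂ) * hl2
  rw [hpq]
  have hR : ((((1 - t) ^ n)⁻¹ : ℝ) * Complex.exp (-(a * L * hnormSq w : ℝ))) *
      ((Real.pi / (s + a * L : ℝ) : ℂ) ^ n *
        Complex.exp (((4 * L ^ 2 * (a ^ 2 - 1) * hnormSq w : ℝ) : ℂ) / (4 * (s + a * L : ℝ)))) =
      (((((1 - t) ^ n)⁻¹ * (Real.pi / (s + a * L)) ^ n) * Real.exp (-(a * L * hnormSq w) +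
        4 * L ^ 2 * (a ^ 2 - 1) * hnormSq w / (4 * (s + a * L))) : ℝ) : ℂ) := by
    rw [Real.exp_add]
    push_cast
    ring
  rw [hR]
  congr 1
  have hT : 0 < s + L - t * (s - L) := by nlinarith
  have hT' : 1 - t * ((s - L) / (s + L)) = (s + L - t * (s - L)) / (s + L) := by
    field_simp
  have hT2 : 1 + t * ((s - L) / (s + L)) = (s + L + t * (s - L)) / (s + L) := by
    field_simp
  have hsa : s + a * L = (s + L - t * (s - L)) / (1 - t) := by
    rw [ha]; field_simp; ring
  rw [hT', hT2, ← mul_assoc]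
  congr 1
  · rw [hsa, ← inv_pow, ← inv_pow, ← mul_pow, ← mul_pow]
    congr 1
    field_simp
  · congr 1
    rw [hsa, ha]
    field_simp
    ring

lemma psi_zero (n m : ℕ) (hn : 1 ≤ n) (lam : ℝ) : psi n m lam 0 = (m + n - 1).choose m := by
  have : hnormSq (0 : Fin n → ℂ) = 0 := by simp [hnormSq]
  rw [psi, this, mul_zero, lag_zero, ← Nat.add_sub_assoc hn]
  simp

lemma Iint_eq (n m : ℕ) (hn : 1 ≤ n) (lam s : ℝ) (hs : 0 < s) (w : Fin n → ℂ) :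
    Iint n m lam s w = (((Real.pi / (s + |lam|)) ^ n * ((s - |lam|) / (s + |lam|)) ^ m *
      psi n m lam w : ℝ) : ℂ) := by
  refine coeff_unique (fun m => Iint n m lam s w) (fun m => (((Real.pi / (s + |lam|)) ^ n *
    ((s - |lam|) / (s + |lam|)) ^ m * psi n m lam w : ℝ) : ℂ)) (1/3) (by norm_num) _
    (fun t ht => Iint_hasSum n hn lam s hs w t ht) (fun t ht => ?_) m
  rw [Iint_closed n lam s hs w t ht]
  have hL := abs_nonneg lam
  have hsL : 0 < s + |lam| := by positivity
  have hr : |(s - |lam|) / (s + |lam|)| ≤ 1 := by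
    rw [abs_div, abs_of_pos hsL, div_le_one hsL, abs_le]
    constructor <;> linarith
  have hT : |t * ((s - |lam|) / (s + |lam|))| < 1 := by
    rw [abs_mul]
    have := mul_le_mul_of_nonneg_left hr (abs_nonneg t)
    linarith
  have h := Complex.hasSum_ofReal.2 ((psi_gen n hn lam w _ hT).mul_left ((Real.pi / (s + |lam|)) ^ n))
  convert! h using 2 with m
  rw [← Complex.ofReal_mul]
  congr 1
  rw [mul_pow]
  ring

lemma Iint_key (n m : ℕ) (hn : 1 ≤ n) (lam s : ℝ) (hs : 0 < s) (w : Fin n → ℂ) :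
    Iint n m lam s w = ((m + n - 1).choose m : ℂ)⁻¹ * psi n m lam w * Iint n m lam s 0 := by
  rw [Iint_eq n m hn lam s hs w, Iint_eq n m hn lam s hs 0, psi_zero n m hn]
  have : ((m + n - 1).choose m : ℂ) ≠ 0 := by
    exact_mod_cast (Nat.choose_pos (by omega)).ne'
  push_cast
  field_simp

section Radial
open Set Metric

variable {E : Type*} [NormedAddCommGroup E] [NormedSpace ℝ E] [MeasurableSpace E]
  [BorelSpace E] [FiniteDimensional ℝ E] [Nontrivial E]

lemma polar_eq (μ : Measure E) [μ.IsAddHaarMeasure] {G : Type*} [NormedAddCommGroup G]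
    [NormedSpace ℝ G] (H : E → G) (hH : Integrable H μ) :
    Integrable (fun p : sphere (0 : E) 1 × Ioi (0 : ℝ) => H (p.2.1 • p.1.1))
      (μ.toSphere.prod (.volumeIoiPow (Module.finrank ℝ E - 1))) ∧
    ∫ x, H x ∂μ = ∫ r : Ioi (0 : ℝ), ∫ σ : sphere (0 : E) 1, H (r.1 • σ.1) ∂μ.toSphere
      ∂(Measure.volumeIoiPow (Module.finrank ℝ E - 1)) := by
  have hmp := μ.measurePreserving_homeomorphUnitSphereProd
  have hcomp : (fun p : sphere (0 : E) 1 × Ioi (0 : ℝ) => H (p.2.1 • p.1.1)) ∘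
      (homeomorphUnitSphereProd E) = fun x : ({0}ᶜ : Set E) => H x.1 := by
    funext x
    have hx : ‖x.1‖ ≠ 0 := norm_ne_zero_iff.2 x.2
    simp [smul_smul, hx]
  have hI : Integrable (fun p : sphere (0 : E) 1 × Ioi (0 : ℝ) => H (p.2.1 • p.1.1))
      (μ.toSphere.prod (.volumeIoiPow (Module.finrank ℝ E - 1))) := by
    rw [← hmp.integrable_comp_emb (Homeomorph.measurableEmbedding _), hcomp]
    have := (integrableOn_iff_comap_subtypeVal (μ := μ) (f := H) (s := ({0}ᶜ : Set E))
      (measurableSet_singleton _).compl).1 hH.integrableOn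
    exact this
  refine ⟨hI, ?_⟩
  rw [← integral_prod_symm _ hI, ← hmp.integral_comp (Homeomorph.measurableEmbedding _)]
  have : ∀ x, H (((homeomorphUnitSphereProd E) x).2.1 • ((homeomorphUnitSphereProd E) x).1.1) = H x.1 :=
    fun x => congrFun hcomp x
  simp_rw [this]
  rw [integral_subtype_comap (measurableSet_singleton _).compl fun x ↦ H x,
        restrict_compl_singleton]

lemma radial_uniq_real (μ : Measure E) [μ.IsAddHaarMeasure] (D : E → ℝ) (hD : Continuous D)
    (C : ℝ) (hC : ∀ x, |D x| ≤ C)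
    (hint : ∀ s : ℝ, 0 < s → Integrable (fun x : E => Real.exp (-s * ‖x‖ ^ 2)) μ)
    (h0 : ∀ s : ℝ, 0 < s → ∫ x, Real.exp (-s * ‖x‖ ^ 2) * D x ∂μ = 0) :
    ∀ᵐ r : Ioi (0 : ℝ) ∂(Measure.volumeIoiPow (Module.finrank ℝ E - 1)),
      ∫ σ : sphere (0 : E) 1, D (r.1 • σ.1) ∂μ.toSphere = 0 := by
  set ν := Measure.volumeIoiPow (Module.finrank ℝ E - 1) with hν
  set A : ℝ → ℝ := fun r => ∫ σ : sphere (0 : E) 1, D (r • σ.1) ∂μ.toSphere with hA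
  have hAc : Continuous A := by
    refine continuous_of_dominated (bound := fun _ => C) ?_ ?_ ?_ ?_
    · intro r
      exact Continuous.aestronglyMeasurable (by fun_prop)
    · intro r; exact Filter.Eventually.of_forall fun σ => hC _
    · exact integrable_const _
    · exact Filter.Eventually.of_forall fun σ => by fun_prop
  have hnorm : ∀ (r : Ioi (0 : ℝ)) (σ : sphere (0 : E) 1), ‖r.1 • σ.1‖ = r.1 := by
    intro r σ
    rw [norm_smul, Real.norm_of_nonneg r.2.out.le]
    simp
  have hDI : ∀ s : ℝ, 0 < s → Integrable (fun x => Real.exp (-s * ‖x‖ ^ 2) * D x) μ := by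
    intro s hs
    exact (hint s hs).mul_bdd (c := C) hD.aestronglyMeasurable (Filter.Eventually.of_forall hC)
  have hexpA : ∀ s : ℝ, 0 < s → Integrable (fun r : Ioi (0 : ℝ) => Real.exp (-s * r.1 ^ 2) * A r) ν ∧
      ∫ r : Ioi (0 : ℝ), Real.exp (-s * r.1 ^ 2) * A r ∂ν = 0 := by
    intro s hs
    obtain ⟨h1, h2⟩ := polar_eq μ _ (hDI s hs)
    rw [h0 s hs] at h2
    have h3 := h1.integral_prod_right
    simp only [hnorm, integral_const_mul] at h2 h3
    exact ⟨h3, h2.symm⟩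
  set e : Ioi (0 : ℝ) → ℝ := fun r => Real.exp (-1 * r.1 ^ 2) with he
  have he0 : ∀ r, 0 < e r := fun r => Real.exp_pos _
  have he1 : ∀ r, e r ≤ 1 := fun r => Real.exp_le_one_iff.2 (by nlinarith [sq_nonneg r.1])
  have hec : Continuous e := by fun_prop
  have hAI : Integrable (fun r : Ioi (0 : ℝ) => e r * A r) ν := (hexpA 1 one_pos).1
  have hpoly : ∀ P : Polynomial ℝ, ∫ r, P.eval (e r) * (e r * A r) ∂ν = 0 := by
    intro P
    simp_rw [Polynomial.eval_eq_sum_range, Finset.sum_mul]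
    have hk : ∀ (k : ℕ) (r : Ioi (0 : ℝ)), P.coeff k * e r ^ k * (e r * A r) =
        P.coeff k * (Real.exp (-(k + 1 : ℝ) * r.1 ^ 2) * A r) := by
      intro k r
      rw [he, ← Real.exp_nat_mul]
      simp only
      rw [mul_assoc, ← mul_assoc (Real.exp _) (Real.exp _), ← Real.exp_add]
      congr 3
      ring_nf
    simp_rw [hk]
    rw [integral_finsetSum _ (fun k _ => ((hexpA ((k : ℕ) + 1 : ℝ) (by positivity)).1.const_mul _))]
    refine Finset.sum_eq_zero fun k _ => ?_
    rw [integral_const_mul, (hexpA (k + 1) (by positivity)).2, mul_zero]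
  obtain ⟨C', hC'⟩ : ∃ C', ∀ r, |A r| ≤ C' :=
    ⟨C * μ.toSphere.real univ, fun r => by
      rw [← Real.norm_eq_abs]
      exact norm_integral_le_of_norm_le_const (Filter.Eventually.of_forall fun σ => hC _)⟩
  set φ : ℝ → ℝ := fun y => A (√(-Real.log y)) * y with hφ
  have hφe : ∀ r, φ (e r) = A r * e r := by
    intro r
    simp only [hφ, he, Real.log_exp]
    rw [show -(-1 * r.1 ^ 2) = r.1 ^ 2 by ring, Real.sqrt_sq r.2.out.le]
  have hφc : ContinuousOn φ (Icc 0 1) := by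
    apply Continuous.continuousOn
    rw [continuous_iff_continuousAt]
    intro y
    by_cases hy : y = 0
    · subst hy
      have : φ 0 = 0 := by simp [hφ]
      rw [ContinuousAt, this]
      refine squeeze_zero_norm (a := fun y => C' * |y|) (fun y => ?_) ?_
      · rw [hφ, Real.norm_eq_abs, abs_mul]
        gcongr
        exact hC' _
      · have : Continuous (fun y : ℝ => C' * |y|) := by fun_prop
        simpa using this.tendsto 0
    · have := Real.continuousAt_log hy
      exact (hAc.continuousAt.comp (Real.continuous_sqrt.continuousAt.comp this.neg)).mul continuousAt_id
  have hφI : Integrable (fun r => φ (e r) * (e r * A r)) ν := by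
    simp_rw [hφe]
    refine hAI.bdd_mul (c := C') (Continuous.aestronglyMeasurable (by fun_prop))
      (Filter.Eventually.of_forall fun r => ?_)
    rw [Real.norm_eq_abs, abs_mul, abs_of_pos (he0 r)]
    calc _ ≤ |A r| * 1 := by gcongr; exact he1 r
      _ ≤ C' := by rw [mul_one]; exact hC' _
  have hz : ∫ r, φ (e r) * (e r * A r) ∂ν = 0 := by
    by_contra hne
    set K := ∫ r, |e r * A r| ∂ν with hK
    have hK0 : 0 ≤ K := integral_nonneg fun r => abs_nonneg _
    have hpos : 0 < |∫ r, φ (e r) * (e r * A r) ∂ν| := abs_pos.2 hne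
    set J := |∫ r, φ (e r) * (e r * A r) ∂ν| with hJ
    obtain ⟨P, hP⟩ := exists_polynomial_near_of_continuousOn 0 1 φ hφc (J / (K + 1))
      (by positivity)
    have hPI : Integrable (fun r => P.eval (e r) * (e r * A r)) ν := by
      have : Integrable (fun r => (P.eval (e r) - φ (e r)) * (e r * A r)) ν := by
        refine hAI.bdd_mul (c := J / (K + 1)) ?_ (Filter.Eventually.of_forall fun r =>
          (hP (e r) ⟨(he0 r).le, he1 r⟩).le)
        simp_rw [hφe]
        exact Continuous.aestronglyMeasurable (by fun_prop)
      refine (this.add hφI).congr (Filter.Eventually.of_forall fun r => ?_)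
      simp only [Pi.add_apply]
      ring
    have h1 : ∫ r, (φ (e r) - P.eval (e r)) * (e r * A r) ∂ν = ∫ r, φ (e r) * (e r * A r) ∂ν := by
      simp_rw [sub_mul]
      rw [integral_sub hφI hPI, hpoly, sub_zero]
    have h2b : |∫ r, (φ (e r) - P.eval (e r)) * (e r * A r) ∂ν|
        ≤ ∫ r, J / (K + 1) * |e r * A r| ∂ν := by
      rw [← Real.norm_eq_abs]
      refine norm_integral_le_of_norm_le (hAI.abs.const_mul _) (Filter.Eventually.of_forall fun r => ?_)
      rw [Real.norm_eq_abs, abs_mul, abs_sub_comm]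
      gcongr
      exact (hP (e r) ⟨(he0 r).le, he1 r⟩).le
    have h2 : J ≤ ∫ r, J / (K + 1) * |e r * A r| ∂ν := by
      rw [h1] at h2b
      exact h2b
    rw [integral_const_mul, ← hK, div_mul_eq_mul_div, le_div_iff₀ (by positivity)] at h2
    nlinarith
  have hz2 := (integral_eq_zero_iff_of_nonneg (fun r => ?_) hφI).1 hz
  · filter_upwards [hz2] with r hr
    rw [hφe] at hr
    simp only [Pi.zero_apply, mul_eq_zero, (he0 r).ne', or_false, false_or, or_self] at hr
    exact hr
  · rw [hφe]
    simp only [Pi.zero_apply]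
    nlinarith [sq_nonneg (A r * e r)]

lemma radial_uniq (μ : Measure E) [μ.IsAddHaarMeasure] (D : E → ℂ) (hD : Continuous D)
    (C : ℝ) (hC : ∀ x, ‖D x‖ ≤ C)
    (hint : ∀ s : ℝ, 0 < s → Integrable (fun x : E => Real.exp (-s * ‖x‖ ^ 2)) μ)
    (h0 : ∀ s : ℝ, 0 < s → ∫ x, (Real.exp (-s * ‖x‖ ^ 2) : ℂ) * D x ∂μ = 0)
    (F : E → ℂ) (hF : Integrable F μ) (hrad : ∀ x y, ‖x‖ = ‖y‖ → F x = F y) :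
    ∫ x, F x * D x ∂μ = 0 := by
  have hDI : ∀ s : ℝ, 0 < s → Integrable (fun x => (Real.exp (-s * ‖x‖ ^ 2) : ℂ) * D x) μ := by
    intro s hs
    exact (hint s hs).ofReal.mul_bdd (c := C) hD.aestronglyMeasurable (Filter.Eventually.of_forall hC)
  have hre := radial_uniq_real μ (fun x => (D x).re) (by fun_prop) C
    (fun x => (Complex.abs_re_le_norm _).trans (hC x)) hint (fun s hs => by
      have h := congrArg Complex.re (h0 s hs)
      rw [← RCLike.re_eq_complex_re, ← integral_re (hDI s hs)] at h
      simpa only [RCLike.re_eq_complex_re, Complex.re_ofReal_mul, Complex.zero_re] using h)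
  have him := radial_uniq_real μ (fun x => (D x).im) (by fun_prop) C
    (fun x => (Complex.abs_im_le_norm _).trans (hC x)) hint (fun s hs => by
      have h := congrArg Complex.im (h0 s hs)
      rw [← RCLike.im_eq_complex_im, ← integral_im (hDI s hs)] at h
      simpa only [RCLike.im_eq_complex_im, Complex.im_ofReal_mul, Complex.zero_im] using h)
  have hFD : Integrable (fun x => F x * D x) μ :=
    hF.mul_bdd (c := C) hD.aestronglyMeasurable (Filter.Eventually.of_forall hC)
  rw [(polar_eq μ _ hFD).2]
  refine integral_eq_zero_of_ae ?_
  obtain ⟨x0, hx0⟩ := exists_norm_eq E (zero_le_one (α := ℝ))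
  filter_upwards [hre, him] with r hr hi
  have hn : ∀ σ : sphere (0 : E) 1, F (r.1 • σ.1) = F (r.1 • x0) := by
    intro σ
    apply hrad
    rw [norm_smul, norm_smul, hx0]
    simp
  simp_rw [hn]
  rw [integral_const_mul]
  have hI : Integrable (fun σ : sphere (0 : E) 1 => D (r.1 • σ.1)) μ.toSphere :=
    Integrable.of_bound (C := C) (Continuous.aestronglyMeasurable (by fun_prop))
      (Filter.Eventually.of_forall fun σ => hC _)
  have : ∫ σ : sphere (0 : E) 1, D (r.1 • σ.1) ∂μ.toSphere = 0 := by
    apply Complex.ext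
    · rw [← RCLike.re_eq_complex_re, ← integral_re hI]
      exact hr
    · rw [← RCLike.im_eq_complex_im, ← integral_im hI]
      exact hi
  rw [this, mul_zero, Pi.zero_apply]

end Radial

lemma radial_uniq_pi (n : ℕ) (hn : 1 ≤ n) (D : (Fin n → ℂ) → ℂ) (hD : Continuous D)
    (C : ℝ) (hC : ∀ x, ‖D x‖ ≤ C)
    (h0 : ∀ s : ℝ, 0 < s → ∫ x, (Real.exp (-s * hnormSq x) : ℂ) * D x = 0)
    (F : (Fin n → ℂ) → ℂ) (hF : Integrable F) (hrad : ∀ x y, hnormSq x = hnormSq y → F x = F y) :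
    ∫ x, F x * D x = 0 := by
  let L : EuclideanSpace ℂ (Fin n) ≃L[ℝ] (Fin n → ℂ) :=
    (PiLp.continuousLinearEquiv 2 ℝ (fun _ : Fin n => ℂ))
  let M : (Fin n → ℂ) ≃ᵐ EuclideanSpace ℂ (Fin n) := L.symm.toHomeomorph.toMeasurableEquiv
  let μ : Measure (EuclideanSpace ℂ (Fin n)) := Measure.map L.symm volume
  haveI : μ.IsAddHaarMeasure := L.symm.isAddHaarMeasure_map volume
  haveI : Nonempty (Fin n) := ⟨⟨0, hn⟩⟩
  haveI : Nontrivial (EuclideanSpace ℂ (Fin n)) := L.toEquiv.nontrivial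
  haveI : FiniteDimensional ℝ (EuclideanSpace ℂ (Fin n)) := Module.Finite.equiv L.symm.toLinearEquiv
  have hmp : MeasurePreserving M volume μ := ⟨M.measurable, rfl⟩
  have hnm : ∀ x : EuclideanSpace ℂ (Fin n), ‖x‖ ^ 2 = hnormSq (L x) := by
    intro x
    rw [EuclideanSpace.norm_sq_eq, hnormSq]
    refine Finset.sum_congr rfl fun j _ => ?_
    rw [Complex.normSq_eq_norm_sq]
    rfl
  have hLM : ∀ x, L (M x) = x := fun x => L.apply_symm_apply x
  have key := radial_uniq μ (fun x => D (L x)) (hD.comp L.continuous) C (fun x => hC _)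
    (fun s hs => by
      rw [← hmp.integrable_comp_emb M.measurableEmbedding]
      refine (gauss_integrable s hs).congr (Filter.Eventually.of_forall fun z => ?_)
      simp only [Function.comp, hnm, hLM])
    (fun s hs => by
      rw [← hmp.integral_comp M.measurableEmbedding]
      simp only [hnm, hLM]
      exact h0 s hs)
    (fun x => F (L x))
    (by
      rw [← hmp.integrable_comp_emb M.measurableEmbedding]
      refine hF.congr (Filter.Eventually.of_forall fun z => ?_)
      simp only [Function.comp, hLM])
    (fun x y hxy => hrad _ _ (by rw [← hnm, ← hnm, hxy]))
  rw [← hmp.integral_comp M.measurableEmbedding] at key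
  simpa only [hLM] using key

lemma key_slice (n m : ℕ) (hn : 1 ≤ n) (lam : ℝ) (w : Fin n → ℂ)
    (F : (Fin n → ℂ) → ℂ) (hF : Integrable F) (hrad : ∀ x y, hnormSq x = hnormSq y → F x = F y) :
    ∫ z, F z * (Complex.exp (Complex.I * (2 * lam * (hprod z w).im : ℝ)) *
        (psi n m lam (z + w) : ℂ)) =
      ((m + n - 1).choose m : ℂ)⁻¹ * psi n m lam w * ∫ z, F z * (psi n m lam z : ℂ) := by
  obtain ⟨C, hC⟩ := psi_bound n m lam
  have hpc := psi_cont n m lam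
  have hcw := hprod_cont w
  have hC1 : ∀ z, ‖(psi n m lam z : ℂ)‖ ≤ C := fun z => by
    rw [Complex.norm_real]; exact hC z
  have hP : ∀ z, ‖Complex.exp (Complex.I * (2 * lam * (hprod z w).im : ℝ)) *
        (psi n m lam (z + w) : ℂ)‖ ≤ C := fun z => by
    rw [norm_mul, norm_phase, one_mul]; exact hC1 _
  have hPc : Continuous fun z => Complex.exp (Complex.I * (2 * lam * (hprod z w).im : ℝ)) *
        (psi n m lam (z + w) : ℂ) := by fun_prop
  have hpsc : Continuous fun z => (psi n m lam z : ℂ) := by fun_prop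
  set c : ℂ := ((m + n - 1).choose m : ℂ)⁻¹ * psi n m lam w with hc
  have hspl : ∀ G : (Fin n → ℂ) → ℂ, Integrable G →
      ∫ z, G z * (Complex.exp (Complex.I * (2 * lam * (hprod z w).im : ℝ)) *
        (psi n m lam (z + w) : ℂ) - c * psi n m lam z) =
      (∫ z, G z * (Complex.exp (Complex.I * (2 * lam * (hprod z w).im : ℝ)) *
        (psi n m lam (z + w) : ℂ))) - c * ∫ z, G z * (psi n m lam z : ℂ) := by
    intro G hG
    rw [← integral_const_mul, ← integral_sub]
    · congr 1
      funext z
      ring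
    · exact hG.mul_bdd (c := C) hPc.aestronglyMeasurable (Filter.Eventually.of_forall hP)
    · exact (hG.mul_bdd (c := C) hpsc.aestronglyMeasurable
        (Filter.Eventually.of_forall hC1)).const_mul _
  rw [← sub_eq_zero, ← hspl F hF]
  refine radial_uniq_pi n hn _ (by fun_prop) (C + ‖c‖ * C) (fun z => ?_) (fun s hs => ?_) F hF hrad
  · refine (norm_sub_le _ _).trans (add_le_add (hP z) ?_)
    rw [norm_mul]
    gcongr
    exact hC1 z
  · have hsp := hspl (fun z => (Real.exp (-s * hnormSq z) : ℂ)) (gauss_integrable s hs).ofReal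
    refine hsp.trans ?_
    rw [sub_eq_zero]
    have h := Iint_key n m hn lam s hs w
    have h0 : Iint n m lam s 0 = ∫ z : Fin n → ℂ, (Real.exp (-s * hnormSq z) : ℂ) *
        (psi n m lam z : ℂ) := by
      rw [Iint]
      congr 1
      funext z
      have : (hprod z 0).im = 0 := by simp [hprod]
      rw [this]
      simp
    rw [h0] at h
    exact h

/-- The (unnormalised) spherical function. -/
noncomputable def sph (n m : ℕ) (lam : ℝ) (p : (Fin n → ℂ) × ℝ) : ℂ :=
  Complex.exp (Complex.I * (lam * p.2 : ℝ)) * (psi n m lam p.1 : ℂ)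

lemma sph_cont (n m : ℕ) (lam : ℝ) : Continuous (sph n m lam) := by
  unfold sph
  have := psi_cont n m lam
  fun_prop

lemma sph_bound (n m : ℕ) (lam : ℝ) : ∃ C, ∀ z, ‖sph n m lam z‖ ≤ C := by
  obtain ⟨C, hC⟩ := psi_bound n m lam
  refine ⟨C, fun z => ?_⟩
  rw [sph, norm_mul, norm_phase, one_mul, Complex.norm_real]
  exact hC _

lemma sphFT_eq (n m : ℕ) (lam : ℝ) (f : (Fin n → ℂ) × ℝ → ℂ) :
    sphFT n f m lam = ((m + n - 1).choose m : ℂ)⁻¹ * ∫ p, f p * sph n m lam p := by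
  rw [sphFT]
  congr 2
  funext p
  rw [sph, psi]
  push_cast
  ring_nf

lemma hMul_cont (n : ℕ) : Continuous (fun p : ((Fin n → ℂ) × ℝ) × ((Fin n → ℂ) × ℝ) =>
    hMul p.1 p.2) := by
  unfold hMul hprod
  fun_prop

lemma hInv_cont (n : ℕ) : Continuous (hInv (n := n)) := by
  unfold hInv
  fun_prop

lemma hprod_self_im {n : ℕ} (z : Fin n → ℂ) : (hprod z z).im = 0 := by
  simp [hprod, Complex.mul_conj]

lemma hprod_add_left {n : ℕ} (z z' w : Fin n → ℂ) : hprod (z + z') w = hprod z w + hprod z' w := by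
  simp [hprod, add_mul, Finset.sum_add_distrib]

lemma hprod_neg_right {n : ℕ} (z w : Fin n → ℂ) : hprod z (-w) = - hprod z w := by
  simp [hprod]

lemma hMul_cancel {n : ℕ} (u v : (Fin n → ℂ) × ℝ) : hMul (hMul u v) (hInv v) = u := by
  unfold hMul hInv
  ext1
  · simp
  · simp [hprod_neg_right, hprod_add_left, hprod_self_im]
    ring

lemma hMul_cancel' {n : ℕ} (u v : (Fin n → ℂ) × ℝ) : hMul (hMul u (hInv v)) v = u := by
  unfold hMul hInv
  ext1
  · simp
  · have : hprod (-v.1) v.1 = - hprod v.1 v.1 := by simp [hprod]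
    simp [hprod_neg_right, hprod_add_left, hprod_self_im, this]
    ring

lemma hMul_mp {n : ℕ} (v : (Fin n → ℂ) × ℝ) :
    MeasurePreserving (fun u => hMul u v) volume volume := by
  have h := MeasurePreserving.skew_product (μa := (volume : Measure (Fin n → ℂ)))
    (μc := (volume : Measure ℝ)) (μd := (volume : Measure ℝ))
    (measurePreserving_add_right (volume : Measure (Fin n → ℂ)) v.1)
    (g := fun z s => s + v.2 + 2 * (hprod z v.1).im)
    (by
      have h2 : Continuous fun a : (Fin n → ℂ) × ℝ => (hprod a.1 v.1).im :=
        (hprod_cont v.1).comp continuous_fst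
      exact Continuous.measurable
        ((continuous_snd.add continuous_const).add (continuous_const.mul h2)))
    (Filter.Eventually.of_forall fun z => by
      have := (measurePreserving_add_right (volume : Measure ℝ) (v.2 + 2 * (hprod z v.1).im)).map_eq
      simpa only [add_assoc] using this)
  exact h

/-- The shear `(v,u) ↦ (v, u·v)`. -/
noncomputable def shear (n : ℕ) : (((Fin n → ℂ) × ℝ) × ((Fin n → ℂ) × ℝ)) ≃ᵐ
    (((Fin n → ℂ) × ℝ) × ((Fin n → ℂ) × ℝ)) :=
  Homeomorph.toMeasurableEquiv
  { toFun := fun p => (p.1, hMul p.2 p.1)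
    invFun := fun p => (p.1, hMul p.2 (hInv p.1))
    left_inv := fun p => by simp [hMul_cancel]
    right_inv := fun p => by simp [hMul_cancel']
    continuous_toFun := by
      have := hMul_cont n
      exact continuous_fst.prodMk (this.comp (continuous_snd.prodMk continuous_fst))
    continuous_invFun := by
      have := hMul_cont n
      exact continuous_fst.prodMk (this.comp (continuous_snd.prodMk
        ((hInv_cont n).comp continuous_fst))) }

lemma shear_apply (n : ℕ) (p) : shear n p = (p.1, hMul p.2 p.1) := rfl

lemma shear_mp (n : ℕ) : MeasurePreserving (shear n)
    ((volume : Measure ((Fin n → ℂ) × ℝ)).prod volume) (volume.prod volume) := by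
  have h := MeasurePreserving.skew_product (μa := (volume : Measure ((Fin n → ℂ) × ℝ)))
    (μc := (volume : Measure ((Fin n → ℂ) × ℝ))) (μd := (volume : Measure ((Fin n → ℂ) × ℝ)))
    (MeasurePreserving.id _) (g := fun v u => hMul u v)
    (((hMul_cont n).comp continuous_swap).measurable)
    (Filter.Eventually.of_forall fun v => (hMul_mp v).map_eq)
  exact h

lemma sph_mul (n m : ℕ) (hn : 1 ≤ n) (lam : ℝ) (f : (Fin n → ℂ) × ℝ → ℂ) (hf : Integrable f)
    (hfrad : ∀ (z z' : Fin n → ℂ) (s : ℝ), hnormSq z = hnormSq z' → f (z, s) = f (z', s))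
    (v : (Fin n → ℂ) × ℝ) :
    ∫ u, f u * sph n m lam (hMul u v) =
      ((m + n - 1).choose m : ℂ)⁻¹ * sph n m lam v * ∫ u, f u * sph n m lam u := by
  obtain ⟨C, hC⟩ := sph_bound n m lam
  have hsc := sph_cont n m lam
  have hsc2 : Continuous fun u => sph n m lam (hMul u v) :=
    hsc.comp ((hMul_cont n).comp (continuous_id.prodMk continuous_const))
  have hI1 : Integrable (fun u => f u * sph n m lam (hMul u v)) :=
    hf.mul_bdd (c := C) hsc2.aestronglyMeasurable (Filter.Eventually.of_forall fun u => hC _)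
  have hI2 : Integrable (fun u => f u * sph n m lam u) :=
    hf.mul_bdd (c := C) hsc.aestronglyMeasurable (Filter.Eventually.of_forall fun u => hC _)
  rw [Measure.volume_eq_prod] at hI1 hI2 hf ⊢
  rw [integral_prod_symm _ hI1, integral_prod_symm _ hI2, ← integral_const_mul]
  refine integral_congr_ae ?_
  filter_upwards [hf.prod_left_ae] with s hs
  have hk := key_slice n m hn lam v.1 (fun z => f (z, s)) hs (fun z z' h => hfrad z z' s h)
  have e1 : ∀ z, f (z, s) * sph n m lam (hMul (z, s) v) =
      (Complex.exp (Complex.I * (lam * s : ℝ)) * Complex.exp (Complex.I * (lam * v.2 : ℝ))) *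
      (f (z, s) * (Complex.exp (Complex.I * (2 * lam * (hprod z v.1).im : ℝ)) *
        (psi n m lam (z + v.1) : ℂ))) := by
    intro z
    have : Complex.exp (Complex.I * (lam * (s + v.2 + 2 * (hprod z v.1).im) : ℝ)) =
        Complex.exp (Complex.I * (lam * s : ℝ)) * Complex.exp (Complex.I * (lam * v.2 : ℝ)) *
        Complex.exp (Complex.I * (2 * lam * (hprod z v.1).im : ℝ)) := by
      rw [← Complex.exp_add, ← Complex.exp_add]
      congr 1
      push_cast
      ring
    simp only [sph, hMul, this]
    ring
  have e2 : ∀ z, f (z, s) * sph n m lam (z, s) =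
      Complex.exp (Complex.I * (lam * s : ℝ)) * (f (z, s) * (psi n m lam z : ℂ)) := by
    intro z
    simp only [sph]
    ring
  simp only [e1, e2]
  rw [integral_const_mul, integral_const_mul, hk, sph]
  ring

theorem statement1 (n : ℕ) (hn : 1 ≤ n) (f g : (Fin n → ℂ) × ℝ → ℂ)
    (hf : Integrable f) (hg : Integrable g)
    (hfrad : ∀ (z z' : Fin n → ℂ) (s : ℝ), hnormSq z = hnormSq z' → f (z, s) = f (z', s))
    (hgrad : ∀ (z z' : Fin n → ℂ) (s : ℝ), hnormSq z = hnormSq z' → g (z, s) = g (z', s)) :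
    Integrable (hConv f g) ∧
      ∀ (m : ℕ) (lam : ℝ), sphFT n (hConv f g) m lam = sphFT n f m lam * sphFT n g m lam := by
  have hmp := shear_mp n
  have hK0 : Integrable (fun p : ((Fin n → ℂ) × ℝ) × ((Fin n → ℂ) × ℝ) => g p.1 * f p.2)
      (volume.prod volume) := hg.mul_prod hf
  have hK : Integrable (fun p : ((Fin n → ℂ) × ℝ) × ((Fin n → ℂ) × ℝ) =>
      f (hMul p.2 (hInv p.1)) * g p.1) (volume.prod volume) := by
    rw [← hmp.integrable_comp_emb (shear n).measurableEmbedding]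
    refine hK0.congr (Filter.Eventually.of_forall fun p => ?_)
    simp only [Function.comp, shear_apply, hMul_cancel]
    ring
  refine ⟨hK.integral_prod_right, fun m lam => ?_⟩
  obtain ⟨C, hC⟩ := sph_bound n m lam
  have hsc := sph_cont n m lam
  have hsc2 : Continuous fun p : ((Fin n → ℂ) × ℝ) × ((Fin n → ℂ) × ℝ) => sph n m lam p.2 :=
    hsc.comp continuous_snd
  have hsc3 : Continuous fun p : ((Fin n → ℂ) × ℝ) × ((Fin n → ℂ) × ℝ) =>
      sph n m lam (hMul p.2 p.1) := hsc.comp ((hMul_cont n).comp continuous_swap)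
  have hKs := hK.mul_bdd (c := C) hsc2.aestronglyMeasurable
    (Filter.Eventually.of_forall fun u => hC _)
  have hK0s := hK0.mul_bdd (c := C) hsc3.aestronglyMeasurable
    (Filter.Eventually.of_forall fun u => hC _)
  rw [sphFT_eq, sphFT_eq, sphFT_eq]
  have h1 : ∫ w, hConv f g w * sph n m lam w =
      ∫ p : ((Fin n → ℂ) × ℝ) × ((Fin n → ℂ) × ℝ),
        f (hMul p.2 (hInv p.1)) * g p.1 * sph n m lam p.2 ∂(volume.prod volume) := by
    rw [integral_prod_symm _ hKs]
    congr 1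
    funext w
    rw [hConv, ← integral_mul_const]
  have h2 : ∫ p : ((Fin n → ℂ) × ℝ) × ((Fin n → ℂ) × ℝ),
        f (hMul p.2 (hInv p.1)) * g p.1 * sph n m lam p.2 ∂(volume.prod volume) =
      ∫ p : ((Fin n → ℂ) × ℝ) × ((Fin n → ℂ) × ℝ),
        g p.1 * f p.2 * sph n m lam (hMul p.2 p.1) ∂(volume.prod volume) := by
    rw [← hmp.integral_comp (shear n).measurableEmbedding]
    congr 1
    funext p
    simp only [shear_apply, hMul_cancel]
    ring
  rw [h1, h2, integral_prod _ hK0s]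
  simp only [mul_assoc, integral_const_mul]
  simp only [sph_mul n m hn lam f hf hfrad]
  have h3 : ∫ v, g v * (((m + n - 1).choose m : ℂ)⁻¹ * sph n m lam v *
      ∫ u, f u * sph n m lam u) = (((m + n - 1).choose m : ℂ)⁻¹ * ∫ u, f u * sph n m lam u) *
      ∫ v, g v * sph n m lam v := by
    rw [← integral_const_mul]
    congr 1
    funext v
    ring
  rw [h3]
  ring
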